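/- arXiv:1803.03149 — 8 statements merged into one kernel-verified Lean document; each statement's English description precedes it below -/
import Mathlib

section
/- If the smooth compactly supported function a vanishes on a neighborhood of the origin, then there exists C' > 0 such that I_k = ∫_D e^{-k φ(t,s)} a(t,s) dt ds = O(e^{-k/C'}) as k → ∞. -/
open MeasureTheory Filter Asymptotics

/-- If the amplitude `a` vanishes on a neighborhood of the origin, then
`I_k = ∫_D e^{-kφ} a` is `O(e^{-k/C'})` as `k → ∞`, for some `C' > 0`. -/
theorem degenerate_stationary_phase_away_from_origin
    (n p : ℕ) (hn : 1 ≤ n)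
    (D : Set ((Fin n → ℝ) × (Fin p → ℝ))) (hDmeas : MeasurableSet D)
    (hconic : ∀ c : ℝ, 0 < c → ∀ x ∈ D, c • x ∈ D)
    (C : ℝ) (hC : 0 < C) (hDC : ∀ x ∈ D, ‖x.2‖ ≤ C * ‖x.1‖)
    (φ : (Fin n → ℝ) × (Fin p → ℝ) → ℂ) (hφ : ContDiff ℝ (⊤ : ℕ∞) φ)
    (hφ0 : ∀ s : Fin p → ℝ, φ (0, s) = 0)
    (hdφ0 : ∀ s : Fin p → ℝ, fderiv ℝ φ (0, s) = 0)
    (hφpos : ∀ (t : Fin n → ℝ) (s : Fin p → ℝ), t ≠ 0 → 0 < (φ (t, s)).re)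
    (e : Fin n → (Fin n → ℝ) × (Fin p → ℝ)) (he : ∀ i, e i = (Pi.single i 1, 0))
    (hHess : (Matrix.of fun i j : Fin n =>
        iteratedFDeriv ℝ 2 (fun x => (φ x).re) 0 ![e i, e j]).PosDef)
    (a : (Fin n → ℝ) × (Fin p → ℝ) → ℂ)
    (ha : ContDiff ℝ (⊤ : ℕ∞) a) (ha' : HasCompactSupport a)
    (ha0 : ∀ᶠ x in nhds (0 : (Fin n → ℝ) × (Fin p → ℝ)), a x = 0) :
    ∃ C' : ℝ, 0 < C' ∧
      (fun k : ℝ => ∫ x in D, Complex.exp (-(k : ℂ) * φ x) * a x)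
        =O[atTop] fun k : ℝ => Real.exp (-k / C') := by
  have ha_zero : (0 : (Fin n → ℝ) × (Fin p → ℝ)) ∉ tsupport a :=
    notMem_tsupport_iff_eventuallyEq.mpr ha0
  have hK : IsCompact (tsupport a ∩ {x | ‖x.2‖ ≤ C * ‖x.1‖}) :=
    ha'.isCompact.inter_right (isClosed_le (by fun_prop) (by fun_prop))
  have hpos : ∀ x ∈ tsupport a ∩ {x | ‖x.2‖ ≤ C * ‖x.1‖}, 0 < (φ x).re := by
    rintro ⟨t, s⟩ ⟨hx, hts : ‖s‖ ≤ C * ‖t‖⟩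
    refine hφpos t s fun ht => ha_zero ?_
    subst ht
    rw [norm_zero, mul_zero, norm_le_zero_iff] at hts
    subst hts
    exact hx
  have hre : Continuous fun x => (φ x).re := Complex.continuous_re.comp hφ.continuous
  obtain ⟨δ, hδ, hδle⟩ := hK.exists_forall_le' hre.continuousOn hpos
  refine ⟨δ⁻¹, inv_pos.mpr hδ, IsBigO.of_bound (∫ x in D, ‖a x‖) ?_⟩
  have hint : Integrable (fun x => ‖a x‖) (volume.restrict D) :=
    (ha.continuous.integrable_of_hasCompactSupport ha').norm.restrict
  filter_upwards [eventually_ge_atTop 0] with k hk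
  rw [Real.norm_of_nonneg (Real.exp_pos _).le, div_inv_eq_mul, mul_comm, ← integral_const_mul]
  refine norm_integral_le_of_norm_le (hint.const_mul _) ?_
  filter_upwards [ae_restrict_mem hDmeas] with x hx
  rw [norm_mul]
  by_cases hax : a x = 0
  · simp [hax]
  · have hle := hδle x ⟨subset_tsupport a hax, hDC x hx⟩
    gcongr
    rw [Complex.norm_exp, ← Complex.ofReal_neg, Complex.re_ofReal_mul]
    exact Real.exp_le_exp.mpr (mul_le_mul_of_nonpos_left hle (neg_nonpos.mpr hk))
end

section
/- Let f : ℝ^n × ℝ^p → ℂ be a smooth compactly supported function such that |f(t,s)| = O((|t| + |s|)^N) as (t,s) → (0,0), for some N ∈ ℕ. Then ∫_D e^{-k q(t)} f(t,s) dt ds = k^{-(n+p)/2} O(k^{-N/2}) as k → ∞. -/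
open MeasureTheory Filter Asymptotics

/-- A continuous function homogeneous of degree two that is positive away from the origin
dominates a positive multiple of the squared norm. -/
lemma exists_pos_mul_norm_sq_le_of_homogeneous {E : Type*} [NormedAddCommGroup E]
    [NormedSpace ℝ E] [FiniteDimensional ℝ E] [Nontrivial E] {g : E → ℝ} (hg : Continuous g)
    (hhom : ∀ (c : ℝ) (x : E), g (c • x) = c ^ 2 * g x) (hpos : ∀ x, x ≠ 0 → 0 < g x) :
    ∃ c > 0, ∀ x, c * ‖x‖ ^ 2 ≤ g x := by
  obtain ⟨u, hu, hmin⟩ := (isCompact_sphere (0 : E) 1).exists_isMinOn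
    (NormedSpace.sphere_nonempty.2 zero_le_one) hg.continuousOn
  have hu1 : ‖u‖ = 1 := by simpa using hu
  refine ⟨g u, hpos u (norm_ne_zero_iff.1 (by simp [hu1])), fun x => ?_⟩
  rcases eq_or_ne x 0 with rfl | hx
  · have h0 : g 0 = 0 := by simpa using hhom 0 0
    simp [h0]
  · have hx' : ‖x‖ ≠ 0 := norm_ne_zero_iff.2 hx
    have hmem : ‖x‖⁻¹ • x ∈ Metric.sphere (0 : E) 1 := by simp [norm_smul, hx']
    have hle : g u ≤ g (‖x‖⁻¹ • x) := hmin hmem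
    calc g u * ‖x‖ ^ 2 ≤ g (‖x‖⁻¹ • x) * ‖x‖ ^ 2 := by gcongr
      _ = g x := by rw [hhom]; field_simp

/-- A bounded function that is `O(‖x‖ ^ N)` at the origin is globally dominated by a multiple
of `‖x‖ ^ N`. -/
lemma exists_norm_le_mul_norm_pow_of_isBigO {E F : Type*} [NormedAddCommGroup E]
    [NormedAddCommGroup F] {f : E → F} {N : ℕ} {B : ℝ} (hB : ∀ x, ‖f x‖ ≤ B)
    (hf : f =O[nhds 0] fun x => ‖x‖ ^ N) : ∃ A, 0 ≤ A ∧ ∀ x, ‖f x‖ ≤ A * ‖x‖ ^ N := by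
  obtain ⟨c, hc, hcf⟩ := hf.exists_pos
  obtain ⟨δ, hδ, hball⟩ := Metric.eventually_nhds_iff.1 hcf.bound
  have hB0 : 0 ≤ B := (norm_nonneg _).trans (hB 0)
  refine ⟨c + B / δ ^ N, by positivity, fun x => ?_⟩
  rcases lt_or_ge ‖x‖ δ with hx | hx
  · have h := hball (y := x) (by simpa using hx)
    rw [norm_pow, norm_norm] at h
    exact h.trans (by gcongr; linarith [show 0 ≤ B / δ ^ N by positivity])
  · calc ‖f x‖ ≤ B := hB x
      _ = B / δ ^ N * δ ^ N := by field_simp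
      _ ≤ (c + B / δ ^ N) * ‖x‖ ^ N := by gcongr; linarith

section Gaussian

variable {E : Type*} [NormedAddCommGroup E] [NormedSpace ℝ E] [FiniteDimensional ℝ E]
  [MeasurableSpace E] [BorelSpace E] (μ : Measure E) [μ.IsAddHaarMeasure]

lemma integrable_norm_pow_mul_exp_neg_mul_norm_sq [Nontrivial E] (N : ℕ) {b : ℝ} (hb : 0 < b) :
    Integrable (fun x : E => ‖x‖ ^ N * Real.exp (-b * ‖x‖ ^ 2)) μ := by
  refine (integrable_fun_norm_addHaar μ (f := fun r : ℝ => r ^ N * Real.exp (-b * r ^ 2))).2 ?_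
  have h := integrableOn_rpow_mul_exp_neg_mul_sq hb
    (s := ((Module.finrank ℝ E - 1 + N : ℕ) : ℝ)) (neg_one_lt_zero.trans_le (Nat.cast_nonneg _))
  refine h.congr_fun (fun x _ => ?_) measurableSet_Ioi
  simp only [Real.rpow_natCast, pow_add, smul_eq_mul, mul_assoc]

lemma integral_norm_pow_mul_exp_neg_mul_norm_sq (N : ℕ) (b : ℝ) {k : ℝ} (hk : 0 < k) :
    ∫ x : E, ‖x‖ ^ N * Real.exp (-(k * b) * ‖x‖ ^ 2) ∂μ =
      k ^ (-((Module.finrank ℝ E : ℝ) + N) / 2) *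
        ∫ x : E, ‖x‖ ^ N * Real.exp (-b * ‖x‖ ^ 2) ∂μ := by
  have hs : 0 < √k := Real.sqrt_pos.2 hk
  have hscale := Measure.integral_comp_smul_of_nonneg μ
    (fun x : E => ‖x‖ ^ N * Real.exp (-b * ‖x‖ ^ 2)) (√k) (hR := hs.le)
  have hpow : k ^ (-((Module.finrank ℝ E : ℝ) + N) / 2) =
      (√k ^ N)⁻¹ * (√k ^ Module.finrank ℝ E)⁻¹ := by
    rw [← mul_inv, ← pow_add, ← Real.rpow_natCast, Real.sqrt_eq_rpow, ← Real.rpow_mul hk.le,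
      ← Real.rpow_neg hk.le]
    congr 1
    push_cast
    ring
  rw [hpow, mul_assoc, ← smul_eq_mul (_⁻¹) (∫ x : E, _ ∂μ), ← hscale, ← integral_const_mul]
  refine integral_congr_ae (.of_forall fun x => ?_)
  simp only [norm_smul, Real.norm_eq_abs, abs_of_pos hs, mul_pow, Real.sq_sqrt hk.le]
  rw [show -(k * b) * ‖x‖ ^ 2 = -b * (k * ‖x‖ ^ 2) by ring]
  field_simp

end Gaussian

/-- The real part of a complex quadratic form whose coefficient matrix has positive definite real
part is coercive. -/
lemma exists_pos_mul_norm_sq_le_re_quadratic {n : ℕ} (hn : 1 ≤ n) (M : Matrix (Fin n) (Fin n) ℂ)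
    (hM : (Matrix.of fun i j : Fin n => (M i j).re).PosDef) :
    ∃ c > 0, ∀ t : Fin n → ℝ, c * ‖t‖ ^ 2 ≤
      (∑ i : Fin n, ∑ j : Fin n, M i j * (t i : ℂ) * (t j : ℂ)).re := by
  have : Nonempty (Fin n) := ⟨⟨0, hn⟩⟩
  have hre (t : Fin n → ℝ) : (∑ i : Fin n, ∑ j : Fin n, M i j * (t i : ℂ) * (t j : ℂ)).re =
      ∑ i : Fin n, ∑ j : Fin n, (M i j).re * t i * t j := by
    simp [Complex.re_sum]
  simp only [hre]
  refine exists_pos_mul_norm_sq_le_of_homogeneous (by fun_prop) (fun c x => ?_) fun x hx => ?_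
  · simp only [Pi.smul_apply, smul_eq_mul, Finset.mul_sum]
    refine Finset.sum_congr rfl fun i _ => Finset.sum_congr rfl fun j _ => by ring
  · have h := hM.dotProduct_mulVec_pos hx
    simp only [dotProduct, Matrix.mulVec, Matrix.of_apply, Finset.mul_sum, star_trivial] at h
    refine h.trans_eq <| Finset.sum_congr rfl fun i _ => Finset.sum_congr rfl fun j _ => by ring

/-- For a smooth compactly supported `f` with `f(t,s) = O((|t|+|s|)^N)`
at the origin, `∫_D e^{-kq(t)} f(t,s) dt ds = k^{-(n+p)/2} O(k^{-N/2})`. -/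
theorem gaussian_integral_conic_vanishing_order
    (n p : ℕ) (hn : 1 ≤ n)
    (D : Set ((Fin n → ℝ) × (Fin p → ℝ))) (hDmeas : MeasurableSet D)
    (hconic : ∀ c : ℝ, 0 < c → ∀ x ∈ D, c • x ∈ D)
    (C : ℝ) (hC : 0 < C) (hDC : ∀ x ∈ D, ‖x.2‖ ≤ C * ‖x.1‖)
    (q : (Fin n → ℝ) → ℂ) (M : Matrix (Fin n) (Fin n) ℂ)
    (hqM : ∀ t : Fin n → ℝ, q t = ∑ i : Fin n, ∑ j : Fin n, M i j * (t i : ℂ) * (t j : ℂ))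
    (hM : (Matrix.of fun i j : Fin n => (M i j).re).PosDef)
    (f : (Fin n → ℝ) × (Fin p → ℝ) → ℂ)
    (hf : ContDiff ℝ (⊤ : ℕ∞) f) (hf' : HasCompactSupport f)
    (N : ℕ)
    (hfN : f =O[nhds (0 : (Fin n → ℝ) × (Fin p → ℝ))] fun x => (‖x.1‖ + ‖x.2‖) ^ N) :
    (fun k : ℝ => ∫ x in D, Complex.exp (-(k : ℂ) * q x.1) * f x)
      =O[atTop] fun k : ℝ => k ^ (-(((n : ℝ) + p) + N) / 2) := by
  have : Nonempty (Fin n) := ⟨⟨0, hn⟩⟩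
  have : (volume : Measure ((Fin n → ℝ) × (Fin p → ℝ))).IsAddHaarMeasure :=
    Measure.prod.instIsAddHaarMeasure _ _
  obtain ⟨c, hc, hcq⟩ := exists_pos_mul_norm_sq_le_re_quadratic hn M hM
  simp only [← hqM] at hcq
  obtain ⟨B, hB⟩ := hf'.exists_bound_of_continuous hf.continuous
  have hsum : (fun x : (Fin n → ℝ) × (Fin p → ℝ) => (‖x.1‖ + ‖x.2‖) ^ N)
      =O[nhds 0] fun x => ‖x‖ ^ N :=
    (isBigO_fst_prod'.norm_norm.add isBigO_snd_prod'.norm_norm).pow N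
  obtain ⟨A, hA, hfA⟩ := exists_norm_le_mul_norm_pow_of_isBigO hB (hfN.trans hsum)
  set b : ℝ := c / (1 + C) ^ 2 with hbdef
  have hb : 0 < b := by positivity
  have hqD : ∀ x ∈ D, b * ‖x‖ ^ 2 ≤ (q x.1).re := fun x hx => by
    have hx1 : ‖x‖ ≤ (1 + C) * ‖x.1‖ := by
      have h1 := norm_nonneg x.1
      refine max_le ?_ ((hDC x hx).trans ?_) <;> nlinarith
    calc b * ‖x‖ ^ 2 ≤ b * ((1 + C) * ‖x.1‖) ^ 2 := by gcongr
      _ = c * ‖x.1‖ ^ 2 := by rw [hbdef]; field_simp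
      _ ≤ (q x.1).re := hcq x.1
  refine IsBigO.of_bound
    (A * ∫ x : (Fin n → ℝ) × (Fin p → ℝ), ‖x‖ ^ N * Real.exp (-b * ‖x‖ ^ 2)) ?_
  filter_upwards [eventually_gt_atTop 0] with k hk
  have hint := (integrable_norm_pow_mul_exp_neg_mul_norm_sq
    (volume : Measure ((Fin n → ℝ) × (Fin p → ℝ))) N (mul_pos hk hb)).const_mul A
  have hbound : ∀ x ∈ D, ‖Complex.exp (-(k : ℂ) * q x.1) * f x‖ ≤
      A * (‖x‖ ^ N * Real.exp (-(k * b) * ‖x‖ ^ 2)) := fun x hx => by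
    have hre : (-(k : ℂ) * q x.1).re ≤ -(k * b) * ‖x‖ ^ 2 := by
      have h := mul_le_mul_of_nonneg_left (hqD x hx) hk.le
      simp only [neg_mul, Complex.neg_re, Complex.re_ofReal_mul]
      linarith
    rw [norm_mul, Complex.norm_exp]
    calc _ ≤ Real.exp (-(k * b) * ‖x‖ ^ 2) * (A * ‖x‖ ^ N) := by
          gcongr
          exact hfA x
      _ = _ := by ring
  calc ‖∫ x in D, Complex.exp (-(k : ℂ) * q x.1) * f x‖
      ≤ ∫ x in D, A * (‖x‖ ^ N * Real.exp (-(k * b) * ‖x‖ ^ 2)) :=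
        norm_integral_le_of_norm_le hint.integrableOn
          ((ae_restrict_mem hDmeas).mono hbound)
    _ ≤ ∫ x, A * (‖x‖ ^ N * Real.exp (-(k * b) * ‖x‖ ^ 2)) :=
        setIntegral_le_integral hint (.of_forall fun x => by positivity)
    _ = _ := by
        rw [integral_const_mul, integral_norm_pow_mul_exp_neg_mul_norm_sq _ N b hk,
          Real.norm_of_nonneg (by positivity)]
        simp only [Module.finrank_prod, Module.finrank_fin_fun, Nat.cast_add]
        ring
end

section
/- Let f : ℝ^n × ℝ^p → ℂ be a smooth function which vanishes on a neighborhood of the origin and satisfies |f(t,s)| = O((|t| + |s|)^N) on all of ℝ^n × ℝ^p, for some N ∈ ℕ. Then there exists C' > 0 such that ∫_D e^{-k q(t)} f(t,s) dt ds = O(e^{-k/C'}) as k → ∞. -/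
open MeasureTheory Filter Asymptotics

/-- A real positive definite quadratic form is bounded below by a positive multiple of the
squared sup norm. -/
lemma Matrix.PosDef.exists_pos_mul_sq_norm_le {ι : Type*} [Fintype ι] [Nonempty ι]
    {A : Matrix ι ι ℝ} (hA : A.PosDef) :
    ∃ a : ℝ, 0 < a ∧ ∀ t : ι → ℝ, a * ‖t‖ ^ 2 ≤ t ⬝ᵥ (A.mulVec t) := by
  have hcont : Continuous fun t : ι → ℝ => t ⬝ᵥ (A.mulVec t) := by
    unfold Matrix.mulVec dotProduct
    fun_prop
  obtain ⟨u, hu, hmin⟩ := (isCompact_sphere (0 : ι → ℝ) 1).exists_isMinOn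
    (NormedSpace.sphere_nonempty.mpr zero_le_one) hcont.continuousOn
  have hu0 : u ≠ 0 := ne_zero_of_mem_unit_sphere ⟨u, hu⟩
  refine ⟨u ⬝ᵥ (A.mulVec u), by simpa using hA.dotProduct_mulVec_pos hu0, fun t => ?_⟩
  rcases eq_or_ne t 0 with rfl | ht
  · simp
  · have htn : 0 < ‖t‖ := norm_pos_iff.mpr ht
    have hmem : ‖t‖⁻¹ • t ∈ Metric.sphere (0 : ι → ℝ) 1 := by
      simp [norm_smul, htn.ne']
    have h : u ⬝ᵥ (A.mulVec u) ≤ (‖t‖⁻¹ • t) ⬝ᵥ (A.mulVec (‖t‖⁻¹ • t)) := hmin hmem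
    rw [Matrix.mulVec_smul, smul_dotProduct, dotProduct_smul, smul_eq_mul, smul_eq_mul] at h
    calc u ⬝ᵥ (A.mulVec u) * ‖t‖ ^ 2
        ≤ ‖t‖⁻¹ * (‖t‖⁻¹ * t ⬝ᵥ (A.mulVec t)) * ‖t‖ ^ 2 := by gcongr
      _ = t ⬝ᵥ (A.mulVec t) := by field_simp

/-- Powers of the norm are integrable against a Gaussian. -/
lemma integrable_norm_pow_mul_exp_neg_mul_sq_norm {E : Type*} [NormedAddCommGroup E]
    [NormedSpace ℝ E] [FiniteDimensional ℝ E] [Nontrivial E] [MeasurableSpace E] [BorelSpace E]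
    (μ : Measure E) [μ.IsAddHaarMeasure] {b : ℝ} (hb : 0 < b) (N : ℕ) :
    Integrable (fun x : E => ‖x‖ ^ N * Real.exp (-b * ‖x‖ ^ 2)) μ := by
  refine (integrable_fun_norm_addHaar μ
    (f := fun y : ℝ => y ^ N * Real.exp (-b * y ^ 2))).mpr ?_
  have h := integrableOn_rpow_mul_exp_neg_mul_sq hb
    (s := ((Module.finrank ℝ E - 1 + N : ℕ) : ℝ)) (by
      have : (0 : ℝ) ≤ ((Module.finrank ℝ E - 1 + N : ℕ) : ℝ) := Nat.cast_nonneg _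
      linarith)
  refine h.congr_fun (fun y _ => ?_) measurableSet_Ioi
  simp only [Real.rpow_natCast, smul_eq_mul]
  ring

/-- For a smooth `f` vanishing near the origin with a global polynomial
bound `|f(t,s)| ≤ c (|t|+|s|)^N`, the integral `∫_D e^{-kq(t)} f(t,s) dt ds` is
exponentially small: `O(e^{-k/C'})` for some `C' > 0`. -/
theorem gaussian_integral_conic_exponential_decay
    (n p : ℕ) (hn : 1 ≤ n)
    (D : Set ((Fin n → ℝ) × (Fin p → ℝ))) (hDmeas : MeasurableSet D)
    (hconic : ∀ c : ℝ, 0 < c → ∀ x ∈ D, c • x ∈ D)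
    (C : ℝ) (hC : 0 < C) (hDC : ∀ x ∈ D, ‖x.2‖ ≤ C * ‖x.1‖)
    (q : (Fin n → ℝ) → ℂ) (M : Matrix (Fin n) (Fin n) ℂ)
    (hqM : ∀ t : Fin n → ℝ, q t = ∑ i : Fin n, ∑ j : Fin n, M i j * (t i : ℂ) * (t j : ℂ))
    (hM : (Matrix.of fun i j : Fin n => (M i j).re).PosDef)
    (f : (Fin n → ℝ) × (Fin p → ℝ) → ℂ) (hf : ContDiff ℝ (⊤ : ℕ∞) f)
    (hf0 : ∀ᶠ x in nhds (0 : (Fin n → ℝ) × (Fin p → ℝ)), f x = 0)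
    (N : ℕ) (c : ℝ) (hfN : ∀ x, ‖f x‖ ≤ c * (‖x.1‖ + ‖x.2‖) ^ N) :
    ∃ C' : ℝ, 0 < C' ∧
      (fun k : ℝ => ∫ x in D, Complex.exp (-(k : ℂ) * q x.1) * f x)
        =O[atTop] fun k : ℝ => Real.exp (-k / C') := by
  have : Nonempty (Fin n) := ⟨⟨0, hn⟩⟩
  obtain ⟨a, ha, hqa⟩ := hM.exists_pos_mul_sq_norm_le
  have hre : ∀ t : Fin n → ℝ, a * ‖t‖ ^ 2 ≤ (q t).re := fun t => by
    refine (hqa t).trans_eq ?_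
    simp only [hqM, dotProduct, Matrix.mulVec, Matrix.of_apply, Finset.mul_sum, Complex.re_sum,
      Complex.re_mul_ofReal]
    exact Finset.sum_congr rfl fun i _ => Finset.sum_congr rfl fun j _ => by ring
  obtain ⟨r, hr, hfr⟩ := Metric.eventually_nhds_iff.mp hf0
  set K : ℝ := max 1 C
  have hK : 0 < K := lt_max_of_lt_left one_pos
  have hxK : ∀ x ∈ D, ‖x‖ ≤ K * ‖x.1‖ := fun x hx => by
    refine max_le ?_ ((hDC x hx).trans ?_)
    · exact le_mul_of_one_le_left (norm_nonneg _) (le_max_left _ _)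
    · exact mul_le_mul_of_nonneg_right (le_max_right _ _) (norm_nonneg _)
  set b : ℝ := a / K ^ 2
  have hb : 0 < b := by positivity
  have hqb : ∀ x ∈ D, b * ‖x‖ ^ 2 ≤ (q x.1).re := fun x hx => by
    refine le_trans ?_ (hre x.1)
    calc b * ‖x‖ ^ 2 ≤ b * (K * ‖x.1‖) ^ 2 := by gcongr; exact hxK x hx
      _ = a * ‖x.1‖ ^ 2 := by simp only [b]; field_simp
  have hfb : ∀ x, ‖f x‖ ≤ |c| * 2 ^ N * ‖x‖ ^ N := fun x => by
    refine (hfN x).trans ?_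
    rw [mul_assoc, ← mul_pow, two_mul]
    gcongr
    · exact le_abs_self c
    · exact norm_fst_le x
    · exact norm_snd_le x
  have : (volume : Measure ((Fin n → ℝ) × (Fin p → ℝ))).IsAddHaarMeasure :=
    Measure.prod.instIsAddHaarMeasure volume volume
  have hint := (integrable_norm_pow_mul_exp_neg_mul_sq_norm
    (volume : Measure ((Fin n → ℝ) × (Fin p → ℝ))) hb N).integrableOn (s := D)
  set I : ℝ := ∫ x in D, ‖x‖ ^ N * Real.exp (-b * ‖x‖ ^ 2)
  refine ⟨1 / (b * r ^ 2), by positivity,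
    IsBigO.of_bound (Real.exp (b * r ^ 2) * (|c| * 2 ^ N) * I) ?_⟩
  filter_upwards [eventually_ge_atTop (1 : ℝ)] with k hk
  have hpt : ∀ x ∈ D, ‖Complex.exp (-(k : ℂ) * q x.1) * f x‖ ≤
      Real.exp (-(k - 1) * (b * r ^ 2)) * (|c| * 2 ^ N) *
        (‖x‖ ^ N * Real.exp (-b * ‖x‖ ^ 2)) := fun x hx => by
    rcases lt_or_ge ‖x‖ r with hxr | hxr
    · rw [hfr (by simpa using hxr), mul_zero, norm_zero]
      positivity
    · have hexp : (-(k : ℂ) * q x.1).re ≤ -(k - 1) * (b * r ^ 2) + -b * ‖x‖ ^ 2 := by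
        have h1 : k * (b * ‖x‖ ^ 2) ≤ k * (q x.1).re :=
          mul_le_mul_of_nonneg_left (hqb x hx) (by linarith)
        have h2 : (k - 1) * (b * r ^ 2) ≤ (k - 1) * (b * ‖x‖ ^ 2) := by
          have : 0 ≤ k - 1 := by linarith
          gcongr
        have h3 : (-(k : ℂ) * q x.1).re = -(k * (q x.1).re) := by simp
        rw [h3]
        linarith
      calc ‖Complex.exp (-(k : ℂ) * q x.1) * f x‖
          = Real.exp (-(k : ℂ) * q x.1).re * ‖f x‖ := by rw [norm_mul, Complex.norm_exp]
        _ ≤ Real.exp (-(k - 1) * (b * r ^ 2) + -b * ‖x‖ ^ 2) * (|c| * 2 ^ N * ‖x‖ ^ N) := by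
            gcongr
            exact hfb x
        _ = _ := by rw [Real.exp_add]; ring
  calc ‖∫ x in D, Complex.exp (-(k : ℂ) * q x.1) * f x‖
      ≤ ∫ x in D, Real.exp (-(k - 1) * (b * r ^ 2)) * (|c| * 2 ^ N) *
          (‖x‖ ^ N * Real.exp (-b * ‖x‖ ^ 2)) :=
        norm_integral_le_of_norm_le (hint.const_mul _)
          ((ae_restrict_iff' hDmeas).mpr (Eventually.of_forall hpt))
    _ = Real.exp (-(k - 1) * (b * r ^ 2)) * (|c| * 2 ^ N) * I := integral_const_mul _ _
    _ = Real.exp (b * r ^ 2) * (|c| * 2 ^ N) * I * ‖Real.exp (-k / (1 / (b * r ^ 2)))‖ := by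
        have h : -(k - 1) * (b * r ^ 2) = b * r ^ 2 + -k / (1 / (b * r ^ 2)) := by
          rw [div_div_eq_mul_div, div_one]; ring
        rw [h, Real.exp_add, Real.norm_eq_abs, Real.abs_exp]
        ring
end

section
/- Let f ∈ C^∞(ℝ, ℂ) be such that for every ℓ ∈ ℕ its ℓ-th derivative f^{(ℓ)} satisfies lim_{x → ±∞} f^{(ℓ)}(x) = 0 and f^{(ℓ)} is integrable on ℝ. Then the series Σ_{ℓ ∈ ℤ} f(ℓ/τ) converges absolutely for every τ > 0, and for every N ∈ ℕ there exists C_N > 0 such that for all τ ≥ 1, | τ^{-1} Σ_{ℓ ∈ ℤ} f(ℓ/τ) − ∫_ℝ f(x) dx | ≤ C_N τ^{-N}. -/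
open MeasureTheory Filter

open scoped FourierTransform

theorem norm_le_intervalIntegral_norm_add_norm_deriv {E : Type*} [NormedAddCommGroup E]
    [NormedSpace ℝ E] [CompleteSpace E] {g : ℝ → E} (hg : ContDiff ℝ 1 g) {a y : ℝ}
    (hy : y ∈ Set.Icc a (a + 1)) :
    ‖g y‖ ≤ ∫ t in a..a + 1, (‖g t‖ + ‖deriv g t‖) := by
  have hd : Continuous (deriv g) := hg.continuous_deriv le_rfl
  have hle : a ≤ a + 1 := by linarith
  have key : ∀ t ∈ Set.Icc a (a + 1), ‖g y‖ ≤ ‖g t‖ + ∫ s in a..a + 1, ‖deriv g s‖ := by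
    intro t ht
    have hftc : ∫ s in t..y, deriv g s = g y - g t :=
      intervalIntegral.integral_deriv_eq_sub
        (fun x _ => (hg.differentiable one_ne_zero).differentiableAt) (hd.intervalIntegrable _ _)
    have hsub : Set.uIoc t y ⊆ Set.uIoc a (a + 1) := by
      rw [Set.uIoc_of_le hle]
      exact Set.Ioc_subset_Ioc (le_min ht.1 hy.1) (max_le ht.2 hy.2)
    have hmono : |∫ s in t..y, ‖deriv g s‖| ≤ |∫ s in a..a + 1, ‖deriv g s‖| :=
      intervalIntegral.abs_integral_mono_interval hsub
        (Eventually.of_forall fun s => norm_nonneg _) (hd.norm.intervalIntegrable _ _)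
    rw [abs_of_nonneg (intervalIntegral.integral_nonneg hle fun s _ => norm_nonneg _)] at hmono
    have h := (intervalIntegral.norm_integral_le_abs_integral_norm (f := deriv g)
      (a := t) (b := y) (μ := volume)).trans hmono
    rw [hftc] at h
    linarith [norm_le_norm_add_norm_sub' (g y) (g t)]
  have hgi := hg.continuous.norm.intervalIntegrable (μ := volume) a (a + 1)
  calc ‖g y‖ = ∫ _ in a..a + 1, ‖g y‖ := by simp
    _ ≤ ∫ t in a..a + 1, (‖g t‖ + ∫ s in a..a + 1, ‖deriv g s‖) :=
      intervalIntegral.integral_mono_on hle (by simp) (hgi.add (by simp)) key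
    _ = ∫ t in a..a + 1, (‖g t‖ + ‖deriv g t‖) := by
      rw [intervalIntegral.integral_add hgi (by simp),
        intervalIntegral.integral_add hgi (hd.norm.intervalIntegrable _ _)]
      simp

theorem summable_norm_restrict_comp_addRight {E : Type*} [NormedAddCommGroup E]
    [NormedSpace ℝ E] [CompleteSpace E] (g : C(ℝ, E)) (hg : ContDiff ℝ 1 g)
    (hi : Integrable g) (hi' : Integrable (deriv g)) (K : TopologicalSpace.Compacts ℝ) :
    Summable fun n : ℤ => ‖(g.comp <| ContinuousMap.addRight (n : ℝ)).restrict K‖ := by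
  set A : ℤ → ℝ := fun n => ∫ t in (n : ℝ)..n + 1, (‖g t‖ + ‖deriv g t‖) with hA
  have hAs : Summable A := by
    simpa [hA] using ((hi.norm.add hi'.norm).hasSum_intervalIntegral 0).summable
  have hA0 : ∀ n, 0 ≤ A n := fun n =>
    intervalIntegral.integral_nonneg (by linarith) fun t _ => by positivity
  obtain ⟨M, hM⟩ := K.isCompact.isBounded.exists_norm_le
  have hsum : Summable fun n : ℤ => ∑ j ∈ Finset.Icc ⌊-M⌋ ⌊M⌋, A (n + j) :=
    summable_sum fun j _ => (Equiv.addRight j).summable_iff.mpr hAs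
  refine hsum.of_nonneg_of_le (fun n => norm_nonneg _) fun n => ?_
  rw [ContinuousMap.norm_le _ (Finset.sum_nonneg fun j _ => hA0 _)]
  rintro ⟨x, hx⟩
  have hxM := abs_le.mp (hM x hx)
  have hmem : ⌊x⌋ ∈ Finset.Icc ⌊-M⌋ ⌊M⌋ :=
    Finset.mem_Icc.mpr ⟨Int.floor_mono hxM.1, Int.floor_mono hxM.2⟩
  refine le_trans ?_ (Finset.single_le_sum (f := fun j => A (n + j)) (fun j _ => hA0 _) hmem)
  refine norm_le_intervalIntegral_norm_add_norm_deriv hg ?_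
  have h1 := Int.floor_le x
  have h2 := (Int.lt_floor_add_one x).le
  constructor <;> simp <;> linarith

theorem norm_fourier_le_integral_norm_iteratedDeriv_div {f : ℝ → ℂ}
    (hf : ContDiff ℝ (⊤ : ℕ∞) f) (hint : ∀ k : ℕ, Integrable (iteratedDeriv k f)) (k : ℕ)
    {ξ : ℝ} (hξ : ξ ≠ 0) :
    ‖𝓕 f ξ‖ ≤ (∫ x, ‖iteratedDeriv k f x‖) / |ξ| ^ k := by
  have h := congrFun (Real.fourier_iteratedDeriv hf (fun n _ => hint n) (n := k) le_top) ξ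
  have hb : ‖𝓕 (iteratedDeriv k f) ξ‖ ≤ ∫ x, ‖iteratedDeriv k f x‖ :=
    VectorFourier.norm_fourierIntegral_le_integral_norm _ _ _ _ _
  rw [h, norm_smul, norm_pow] at hb
  rw [le_div_iff₀ (by positivity), mul_comm]
  refine le_trans ?_ hb
  gcongr
  have hpi : (1 : ℝ) ≤ 2 * Real.pi := by linarith [Real.pi_gt_three]
  simp only [norm_mul, Complex.norm_real, Complex.norm_I, Complex.norm_ofNat, Real.norm_eq_abs,
    abs_of_pos Real.pi_pos, mul_one]
  exact le_mul_of_one_le_left (abs_nonneg _) hpi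

theorem Real.fourier_comp_div (f : ℝ → ℂ) {τ : ℝ} (hτ : 0 < τ) (ξ : ℝ) :
    𝓕 (fun x => f (x / τ)) ξ = τ * 𝓕 f (τ * ξ) := by
  rw [Real.fourier_real_eq, Real.fourier_real_eq]
  have h := Measure.integral_comp_div
    (fun x : ℝ => Real.fourierChar (-(x * (τ * ξ))) • f x) τ
  rw [abs_of_pos hτ, Complex.real_smul] at h
  rw [← h]
  congr 1 with x
  congr 3
  field_simp

/-- Euler–Maclaurin type estimate: for a smooth `f : ℝ → ℂ` whose
derivatives all tend to `0` at `±∞` and are integrable, the Riemann sums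
`τ⁻¹ Σ_{ℓ∈ℤ} f(ℓ/τ)` converge absolutely and approximate `∫_ℝ f` to `O(τ^{-N})`
for every `N`. -/
theorem euler_maclaurin_riemann_sum
    (f : ℝ → ℂ) (hf : ContDiff ℝ (⊤ : ℕ∞) f)
    (hlim_top : ∀ ℓ : ℕ, Tendsto (iteratedDeriv ℓ f) atTop (nhds 0))
    (hlim_bot : ∀ ℓ : ℕ, Tendsto (iteratedDeriv ℓ f) atBot (nhds 0))
    (hint : ∀ ℓ : ℕ, Integrable (iteratedDeriv ℓ f)) :
    (∀ τ : ℝ, 0 < τ → Summable fun ℓ : ℤ => ‖f ((ℓ : ℝ) / τ)‖) ∧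
    ∀ N : ℕ, ∃ C : ℝ, 0 < C ∧ ∀ τ : ℝ, 1 ≤ τ →
      ‖τ⁻¹ * (∑' ℓ : ℤ, f ((ℓ : ℝ) / τ)) - ∫ x : ℝ, f x‖ ≤ C * τ ^ (-(N : ℝ)) := by
  have hrestrict : ∀ τ : ℝ, 0 < τ → ∀ (g : C(ℝ, ℂ)), (∀ x, g x = f (x / τ)) →
      ∀ K : TopologicalSpace.Compacts ℝ,
        Summable fun n : ℤ => ‖(g.comp <| ContinuousMap.addRight (n : ℝ)).restrict K‖ := by
    intro τ hτ g hg
    have hgf : (g : ℝ → ℂ) = fun x => f (x / τ) := funext hg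
    have hderiv : deriv (fun x => f (x / τ)) = fun x => τ⁻¹ • deriv f (x / τ) := by
      ext x
      simpa [div_eq_inv_mul] using deriv_comp_mul_left τ⁻¹ f x
    refine summable_norm_restrict_comp_addRight g ?_ ?_ ?_
    · rw [hgf]
      exact (hf.of_le (by simp)).comp (contDiff_id.div_const τ)
    · rw [hgf]
      exact (by simpa using hint 0 : Integrable f).comp_div hτ.ne'
    · rw [hgf, hderiv]
      exact ((by simpa [iteratedDeriv_one] using hint 1 :
        Integrable (deriv f)).comp_div hτ.ne').smul τ⁻¹
  refine ⟨fun τ hτ => ?_, fun N => ?_⟩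
  · refine (hrestrict τ hτ ⟨fun x => f (x / τ), by have := hf.continuous; fun_prop⟩
      (fun _ => rfl) ⟨{0}, isCompact_singleton⟩).of_nonneg_of_le (fun _ => norm_nonneg _)
      fun n => ?_
    refine le_trans (le_of_eq ?_) (ContinuousMap.norm_coe_le_norm _ ⟨0, rfl⟩)
    simp
  set L := ∫ x, ‖iteratedDeriv (N + 2) f x‖ with hL
  have hL0 : 0 ≤ L := integral_nonneg fun _ => norm_nonneg _
  have hS : Summable fun n : ℤ => 1 / |(n : ℝ)| ^ (N + 2) := by
    simpa [abs_inv, abs_pow] using (Real.summable_one_div_int_pow.mpr (by omega : 1 < N + 2)).abs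
  set S := ∑' n : ℤ, 1 / |(n : ℝ)| ^ (N + 2) with hSdef
  have hS0 : 0 ≤ S := tsum_nonneg fun _ => by positivity
  refine ⟨L * S + 1, by positivity, fun τ hτ => ?_⟩
  have hτ0 : 0 < τ := by linarith
  have hbound : ∀ n : ℤ, n ≠ 0 →
      ‖𝓕 f (τ * n)‖ ≤ L * τ ^ (-(N : ℝ)) * (1 / |(n : ℝ)| ^ (N + 2)) := by
    intro n hn
    have hn' : (n : ℝ) ≠ 0 := by exact_mod_cast hn
    refine (norm_fourier_le_integral_norm_iteratedDeriv_div hf hint (N + 2)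
      (mul_ne_zero hτ0.ne' hn')).trans ?_
    rw [← hL, abs_mul, abs_of_pos hτ0, mul_pow, Real.rpow_neg hτ0.le, Real.rpow_natCast,
      div_eq_mul_inv, mul_inv, one_div, ← mul_assoc]
    gcongr
    omega
  have hmajor := hS.mul_left (L * τ ^ (-(N : ℝ)))
  have hdom : ∀ n : ℤ, ‖if n = 0 then 0 else 𝓕 f (τ * n)‖
      ≤ L * τ ^ (-(N : ℝ)) * (1 / |(n : ℝ)| ^ (N + 2)) := by
    intro n
    split_ifs with hn
    · rw [norm_zero]; positivity
    · exact hbound n hn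
  have hFsum : Summable fun n : ℤ => 𝓕 f (τ * n) := by
    refine (Summable.of_norm_bounded hmajor hdom).congr_cofinite ?_
    filter_upwards [(Set.finite_singleton (0 : ℤ)).compl_mem_cofinite] with n hn
    exact if_neg hn
  have hpoisson : ∑' ℓ : ℤ, f ((ℓ : ℝ) / τ) = τ * ∑' n : ℤ, 𝓕 f (τ * n) := by
    have h := Real.tsum_eq_tsum_fourier
      (f := ⟨fun x => f (x / τ), by have := hf.continuous; fun_prop⟩)
      (hrestrict τ hτ0 _ fun _ => rfl)
      (by simpa [Real.fourier_comp_div f hτ0] using hFsum.mul_left (τ : ℂ)) 0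
    simpa [Real.fourier_comp_div f hτ0, tsum_mul_left] using h
  have hzero : 𝓕 f (τ * (0 : ℤ)) = ∫ x, f x := by
    simp [Real.fourier_real_eq]
  rw [hpoisson, hFsum.tsum_eq_add_tsum_ite 0, hzero, ← mul_assoc]
  have hcancel : ((τ⁻¹ : ℝ) : ℂ) * τ = 1 := by
    rw [← Complex.ofReal_mul, inv_mul_cancel₀ hτ0.ne', Complex.ofReal_one]
  push_cast at hcancel ⊢
  rw [hcancel, one_mul, add_sub_cancel_left]
  refine (tsum_of_norm_bounded hmajor.hasSum hdom).trans ?_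
  rw [tsum_mul_left, ← hSdef]
  have := Real.rpow_nonneg hτ0.le (-(N : ℝ))
  nlinarith
end

section
/- The function er is a smooth, strictly increasing bijection from ℝ onto the open interval (0,1). Define δ : (0,1) → ℝ by δ(t) = √π · exp((er^{-1}(t))²). Then δ(1 − t) = δ(t) for all t ∈ (0,1), and δ(t) ~ (1/(2t)) (ln(1/t))^{-1/2} as t → 0⁺, i.e. 2t √(ln(1/t)) · δ(t) → 1 as t → 0⁺. -/
open MeasureTheory Real Filter

/-- The normalised Gaussian integral `π^{-1/2} ∫_{-∞}^x e^{-t²} dt`. -/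
noncomputable def gaussCDF (x : ℝ) : ℝ :=
  (Real.sqrt π)⁻¹ * ∫ t in Set.Iic x, Real.exp (-t ^ 2)

lemma integrable_exp_neg_sq : Integrable (fun t : ℝ => Real.exp (-t ^ 2)) := by
  simpa using integrable_exp_neg_mul_sq (b := 1) one_pos

lemma integral_exp_neg_sq : ∫ t : ℝ, Real.exp (-t ^ 2) = Real.sqrt π := by
  simpa using integral_gaussian 1

lemma gaussCDF_neg (x : ℝ) : gaussCDF (-x) = 1 - gaussCDF x := by
  have hpi : Real.sqrt π ≠ 0 := by positivity
  have h1 : ∫ t in Set.Iic (-x), Real.exp (-t ^ 2) = ∫ t in Set.Ioi x, Real.exp (-t ^ 2) := by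
    have h := integral_comp_neg_Ioi x (fun t : ℝ => Real.exp (-t ^ 2))
    simpa using h.symm
  have h2 := intervalIntegral.integral_Iic_add_Ioi (b := x) (μ := volume)
    integrable_exp_neg_sq.integrableOn integrable_exp_neg_sq.integrableOn
  rw [integral_exp_neg_sq] at h2
  unfold gaussCDF
  rw [h1, eq_sub_iff_add_eq, ← mul_add, add_comm, h2, inv_mul_cancel₀ hpi]

lemma hasDerivAt_gaussCDF (x : ℝ) :
    HasDerivAt gaussCDF ((Real.sqrt π)⁻¹ * Real.exp (-x ^ 2)) x := by
  have hc : Continuous (fun t : ℝ => Real.exp (-t ^ 2)) := by fun_prop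
  have hF : (fun y : ℝ => ∫ t in Set.Iic y, Real.exp (-t ^ 2)) = fun y =>
      (∫ t in Set.Iic (0 : ℝ), Real.exp (-t ^ 2)) + ∫ t in (0 : ℝ)..y, Real.exp (-t ^ 2) := by
    funext y
    rw [← intervalIntegral.integral_Iic_sub_Iic integrable_exp_neg_sq.integrableOn
      integrable_exp_neg_sq.integrableOn]
    ring
  have h : HasDerivAt (fun y : ℝ => ∫ t in Set.Iic y, Real.exp (-t ^ 2))
      (Real.exp (-x ^ 2)) x := by
    rw [hF]
    exact (intervalIntegral.integral_hasDerivAt_right (hc.intervalIntegrable _ _)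
      (hc.stronglyMeasurableAtFilter _ _) hc.continuousAt).const_add _
  exact h.const_mul _

lemma deriv_gaussCDF : deriv gaussCDF = fun x => (Real.sqrt π)⁻¹ * Real.exp (-x ^ 2) :=
  funext fun x => (hasDerivAt_gaussCDF x).deriv

lemma contDiff_gaussCDF : ContDiff ℝ (⊤ : ℕ∞) gaussCDF := by
  rw [contDiff_infty_iff_deriv, deriv_gaussCDF]
  exact ⟨fun x => (hasDerivAt_gaussCDF x).differentiableAt, by fun_prop⟩

lemma strictMono_gaussCDF : StrictMono gaussCDF := by
  apply strictMono_of_deriv_pos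
  intro x
  rw [deriv_gaussCDF]
  positivity

lemma gaussCDF_pos (x : ℝ) : 0 < gaussCDF x := by
  have h : 0 ≤ gaussCDF (x - 1) :=
    mul_nonneg (by positivity) (integral_nonneg fun t => (Real.exp_pos _).le)
  exact h.trans_lt (strictMono_gaussCDF (by linarith))

lemma gaussCDF_lt_one (x : ℝ) : gaussCDF x < 1 := by
  have h := gaussCDF_pos (-x)
  rw [gaussCDF_neg] at h
  linarith

lemma tendsto_gaussCDF_atTop : Tendsto gaussCDF atTop (nhds 1) := by
  have h := (intervalIntegral_tendsto_integral_Ioi (μ := volume) 0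
    integrable_exp_neg_sq.integrableOn tendsto_id).const_mul (Real.sqrt π)⁻¹
  have h' := h.const_add (gaussCDF 0)
  have hpi : Real.sqrt π ≠ 0 := by positivity
  have h2 := intervalIntegral.integral_Iic_add_Ioi (b := (0 : ℝ)) (μ := volume)
    integrable_exp_neg_sq.integrableOn integrable_exp_neg_sq.integrableOn
  rw [integral_exp_neg_sq] at h2
  refine (h'.congr fun x => ?_).trans_eq ?_
  · rw [← intervalIntegral.integral_Iic_sub_Iic integrable_exp_neg_sq.integrableOn
      integrable_exp_neg_sq.integrableOn]
    simp only [gaussCDF, id]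
    ring
  · rw [gaussCDF, ← mul_add, h2, inv_mul_cancel₀ hpi]

lemma tendsto_gaussCDF_neg_atTop : Tendsto (fun x => gaussCDF (-x)) atTop (nhds 0) := by
  simpa [gaussCDF_neg] using tendsto_gaussCDF_atTop.const_sub 1

lemma range_gaussCDF : Set.range gaussCDF = Set.Ioo (0 : ℝ) 1 := by
  apply Set.Subset.antisymm
  · rintro _ ⟨x, rfl⟩
    exact ⟨gaussCDF_pos x, gaussCDF_lt_one x⟩
  · rintro t ⟨h0, h1⟩
    obtain ⟨a, ha⟩ := (tendsto_gaussCDF_neg_atTop.eventually_lt_const h0).exists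
    obtain ⟨b, hb⟩ := (tendsto_gaussCDF_atTop.eventually_const_lt h1).exists
    exact mem_range_of_exists_le_of_exists_ge contDiff_gaussCDF.continuous
      ⟨-a, ha.le⟩ ⟨b, hb.le⟩

lemma tendsto_gaussCDF_neg_mul :
    Tendsto (fun x => 2 * Real.sqrt π * x * Real.exp (x ^ 2) * gaussCDF (-x)) atTop (nhds 1) := by
  have hpi : 0 < Real.sqrt π := by positivity
  have hinv : Tendsto (fun x : ℝ => x⁻¹) atTop (nhds 0) := tendsto_inv_atTop_zero
  have hexp : Tendsto (fun x : ℝ => Real.exp (-x ^ 2)) atTop (nhds 0) :=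
    Real.tendsto_exp_neg_atTop_nhds_zero.comp (tendsto_pow_atTop two_ne_zero)
  have key := HasDerivAt.lhopital_zero_atTop (l := nhds 1)
    (f := fun x => gaussCDF (-x)) (f' := fun x => -((Real.sqrt π)⁻¹ * Real.exp (-x ^ 2)))
    (g := fun x => (2 * Real.sqrt π)⁻¹ * (Real.exp (-x ^ 2) * x⁻¹))
    (g' := fun x => -((Real.sqrt π)⁻¹ * Real.exp (-x ^ 2) * (1 + (x⁻¹) ^ 2 / 2)))
    (Eventually.of_forall fun x => by
      have h := (hasDerivAt_gaussCDF (-x)).comp x (hasDerivAt_neg x)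
      simpa [Function.comp_def] using h)
    (by
      filter_upwards [eventually_gt_atTop 0] with x hx
      have h := ((((hasDerivAt_pow 2 x).neg.exp).mul (hasDerivAt_inv hx.ne')).const_mul
        (2 * Real.sqrt π)⁻¹)
      refine h.congr_deriv ?_
      simp only [Pi.neg_apply]
      push_cast
      field_simp
      ring)
    (by
      filter_upwards with x
      have : 0 < (Real.sqrt π)⁻¹ * Real.exp (-x ^ 2) * (1 + (x⁻¹) ^ 2 / 2) := by positivity
      exact (neg_neg_of_pos this).ne)
    tendsto_gaussCDF_neg_atTop
    (by simpa using (hexp.mul hinv).const_mul (2 * Real.sqrt π)⁻¹)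
    (by
      have h : Tendsto (fun x : ℝ => (1 + (x⁻¹) ^ 2 / 2)⁻¹) atTop (nhds 1) := by
        simpa using (((hinv.pow 2).div_const 2).const_add 1).inv₀ (by norm_num)
      refine h.congr fun x => ?_
      have h1 : 1 + (x⁻¹) ^ 2 / 2 ≠ 0 := by positivity
      have h2 : (Real.sqrt π)⁻¹ * Real.exp (-x ^ 2) ≠ 0 := by positivity
      rw [neg_div_neg_eq, div_mul_cancel_left₀ h2])
  refine key.congr' ?_
  filter_upwards [eventually_gt_atTop 0] with x hx
  rw [Real.exp_neg]
  field_simp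

lemma tendsto_log_gaussCDF_neg_div :
    Tendsto (fun x => Real.log (1 / gaussCDF (-x)) / x ^ 2) atTop (nhds 1) := by
  have hsq : Tendsto (fun x : ℝ => (x ^ 2)⁻¹) atTop (nhds 0) :=
    tendsto_inv_atTop_zero.comp (tendsto_pow_atTop two_ne_zero)
  have hlog : Tendsto (fun x : ℝ => Real.log x / x ^ 2) atTop (nhds 0) := by
    simpa using (isLittleO_log_rpow_atTop (r := 2) two_pos).tendsto_div_nhds_zero
  have hA := (tendsto_gaussCDF_neg_mul.log one_ne_zero).mul hsq
  have h := ((hlog.const_add 1).add (hsq.const_mul (Real.log (2 * Real.sqrt π)))).sub hA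
  simp only [add_zero, mul_zero, sub_zero] at h
  refine h.congr' ?_
  filter_upwards [eventually_gt_atTop 0] with x hx
  have hq := gaussCDF_pos (-x)
  have hpi : 0 < Real.sqrt π := by positivity
  rw [Real.log_mul (x := 2 * Real.sqrt π * x * Real.exp (x ^ 2)) (by positivity) hq.ne',
    Real.log_mul (y := Real.exp (x ^ 2)) (by positivity) (by positivity),
    Real.log_mul (y := x) (by positivity) hx.ne', Real.log_exp, one_div, Real.log_inv]
  field_simp
  ring

lemma tendsto_gaussCDF_neg_density :
    Tendsto (fun x => 2 * gaussCDF (-x) * Real.sqrt (Real.log (1 / gaussCDF (-x))) *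
      (Real.sqrt π * Real.exp (x ^ 2))) atTop (nhds 1) := by
  have h := tendsto_gaussCDF_neg_mul.mul tendsto_log_gaussCDF_neg_div.sqrt
  rw [Real.sqrt_one, one_mul] at h
  refine h.congr' ?_
  filter_upwards [eventually_gt_atTop 0] with x hx
  rw [Real.sqrt_div' _ (by positivity), Real.sqrt_sq hx.le]
  field_simp

lemma tendsto_invFun_gaussCDF :
    Tendsto (Function.invFun gaussCDF) (nhdsWithin 0 (Set.Ioi 0)) atBot := by
  rw [tendsto_atBot]
  intro b
  filter_upwards [Ioo_mem_nhdsGT (gaussCDF_pos b)] with t ht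
  have hmem : t ∈ Set.range gaussCDF := by
    rw [range_gaussCDF]
    exact ⟨ht.1, ht.2.trans (gaussCDF_lt_one b)⟩
  rw [← strictMono_gaussCDF.le_iff_le, Function.invFun_eq hmem]
  exact ht.2.le

/-- `er` is a smooth strictly increasing bijection from `ℝ` onto `(0,1)`,
the density `δ(t) = √π exp((er⁻¹(t))²)` satisfies `δ(1-t) = δ(t)` and
`δ(t) ~ (1/(2t)) (ln(1/t))^{-1/2}` as `t → 0⁺`. -/
theorem er_bijection_and_density_asymptotics
    (er : ℝ → ℝ)
    (her : ∀ x : ℝ, er x = (Real.sqrt π)⁻¹ * ∫ t in Set.Iic x, Real.exp (-t ^ 2))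
    (δ : ℝ → ℝ)
    (hδ : ∀ t : ℝ, δ t = Real.sqrt π * Real.exp ((Function.invFun er t) ^ 2)) :
    ContDiff ℝ (⊤ : ℕ∞) er ∧
    StrictMono er ∧
    Set.range er = Set.Ioo (0 : ℝ) 1 ∧
    (∀ t ∈ Set.Ioo (0 : ℝ) 1, δ (1 - t) = δ t) ∧
    Tendsto (fun t : ℝ => 2 * t * Real.sqrt (Real.log (1 / t)) * δ t)
      (nhdsWithin 0 (Set.Ioi 0)) (nhds 1) := by
  obtain rfl : er = gaussCDF := funext her
  obtain rfl : δ = _ := funext hδ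
  refine ⟨contDiff_gaussCDF, strictMono_gaussCDF, range_gaussCDF, ?_, ?_⟩
  · intro t ht
    rw [← range_gaussCDF] at ht
    obtain ⟨x, rfl⟩ := ht
    have hinv := Function.leftInverse_invFun strictMono_gaussCDF.injective
    simp only [← gaussCDF_neg, hinv _, neg_sq]
  · have h := tendsto_gaussCDF_neg_density.comp
      (tendsto_neg_atBot_atTop.comp tendsto_invFun_gaussCDF)
    refine h.congr' ?_
    filter_upwards [Ioo_mem_nhdsGT (zero_lt_one' ℝ)] with t ht
    rw [← range_gaussCDF] at ht
    simp only [Function.comp_apply, neg_neg, neg_sq, Function.invFun_eq ht]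
end

section
/- Let E be a complex inner product space, P : E → E an orthogonal projection, H a finite-dimensional subspace of E, and T : H → H the linear map determined by ⟨T s, t⟩ = ⟨P s, t⟩ for all s, t ∈ H. Let s_1, …, s_d be an orthonormal basis of H consisting of eigenvectors of T, with T s_i = λ_i s_i. Write s_i = s_i^A + s_i^B where s_i^A = P s_i and s_i^B = (I − P) s_i. Then ⟨s_i^A, s_j^A⟩ = λ_i δ_{ij} and ⟨s_i^B, s_j^B⟩ = (1 − λ_i) δ_{ij} for all i, j ∈ {1, …, d}. -/
open scoped InnerProductSpace

/-- If `(s_i)` is an orthonormal eigenbasis of the compression `T` of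
an orthogonal projection `P` to a finite-dimensional subspace `H`, with eigenvalues
`λ_i`, and `s_i = s_i^A + s_i^B` with `s_i^A = P s_i`, `s_i^B = (I-P) s_i`, then
`⟨s_i^A, s_j^A⟩ = λ_i δ_{ij}` and `⟨s_i^B, s_j^B⟩ = (1-λ_i) δ_{ij}`. -/
theorem eigenbasis_projection_components_orthogonality
    {E : Type*} [NormedAddCommGroup E] [InnerProductSpace ℂ E]
    (P : E →ₗ[ℂ] E)
    (hPsa : ∀ x y : E, ⟪P x, y⟫_ℂ = ⟪x, P y⟫_ℂ)
    (hP2 : ∀ x : E, P (P x) = P x)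
    (H : Submodule ℂ E) [FiniteDimensional ℂ H]
    (T : H →ₗ[ℂ] H)
    (hT : ∀ s t : H, ⟪((T s : H) : E), (t : E)⟫_ℂ = ⟪P (s : E), (t : E)⟫_ℂ)
    (d : ℕ) (s : Fin d → H) (hs : Orthonormal ℂ s)
    (hspan : Submodule.span ℂ (Set.range s) = ⊤)
    (l : Fin d → ℝ) (hEig : ∀ i, T (s i) = (l i : ℂ) • s i) :
    ∀ i j : Fin d,
      (⟪P ((s i : E)), P ((s j : E))⟫_ℂ = if i = j then (l i : ℂ) else 0) ∧
      (⟪((s i : E)) - P ((s i : E)), ((s j : E)) - P ((s j : E))⟫_ℂ =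
        if i = j then (1 : ℂ) - (l i : ℂ) else 0) := by
  intro i j
  have hs' : ⟪(s i : E), (s j : E)⟫_ℂ = if i = j then (1 : ℂ) else 0 :=
    orthonormal_iff_ite.mp hs i j
  have hPs : ⟪P (s i : E), (s j : E)⟫_ℂ = if i = j then (l i : ℂ) else 0 := by
    rw [← hT, hEig, Submodule.coe_smul, inner_smul_left, hs', Complex.conj_ofReal,
      mul_ite, mul_one, mul_zero]
  have hPP : ⟪P (s i : E), P (s j : E)⟫_ℂ = if i = j then (l i : ℂ) else 0 := by
    rw [← hPsa, hP2, hPs]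
  refine ⟨hPP, ?_⟩
  rw [inner_sub_left, inner_sub_right, inner_sub_right, ← hPsa, hs', hPs, hPP]
  split_ifs <;> ring
end

section
/- Define polynomials P_ℓ ∈ ℝ[X] recursively by P_1(X) = X and P_{ℓ+1}(X) = X(1−X) P_ℓ'(X). Then for every λ ∈ (0,1) and every ℓ ≥ 1, the ℓ-th derivative at t = 0 of the function t ↦ ln(1 + (e^t − 1)λ) equals P_ℓ(λ); equivalently, ln(1 + (e^t − 1)λ) = Σ_{ℓ ≥ 1} P_ℓ(λ) t^ℓ / ℓ! as a Taylor expansion at t = 0. -/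
theorem one_add_exp_sub_one_mul_pos {lam : ℝ} (hlam : lam ∈ Set.Ioo (0 : ℝ) 1) (t : ℝ) :
    0 < 1 + (Real.exp t - 1) * lam := by
  nlinarith [mul_pos (Real.exp_pos t) hlam.1, hlam.2]

theorem hasDerivAt_one_add_exp_sub_one_mul (lam t : ℝ) :
    HasDerivAt (fun t : ℝ => 1 + (Real.exp t - 1) * lam) (Real.exp t * lam) t :=
  (((Real.hasDerivAt_exp t).sub_const 1).mul_const lam).const_add 1

/-- The mean `q` of the exponentially tilted Bernoulli distribution solves the logistic
equation `q' = q (1 - q)`. -/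
theorem hasDerivAt_tilted_bernoulli_mean {lam : ℝ} (hlam : lam ∈ Set.Ioo (0 : ℝ) 1) (t : ℝ) :
    HasDerivAt (fun t : ℝ => Real.exp t * lam / (1 + (Real.exp t - 1) * lam))
      (Real.exp t * lam / (1 + (Real.exp t - 1) * lam) *
        (1 - Real.exp t * lam / (1 + (Real.exp t - 1) * lam))) t := by
  have hne := (one_add_exp_sub_one_mul_pos hlam t).ne'
  refine (((Real.hasDerivAt_exp t).mul_const lam).div
    (hasDerivAt_one_add_exp_sub_one_mul lam t) hne).congr_deriv ?_
  generalize 1 + (Real.exp t - 1) * lam = D at hne ⊢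
  field_simp

/-- The derivatives of the Bernoulli cumulant generating function are polynomials in the mean
of the tilted distribution. -/
theorem iteratedDeriv_bernoulli_cgf
    (P : ℕ → Polynomial ℝ)
    (hP1 : P 1 = Polynomial.X)
    (hPrec : ∀ ℓ : ℕ, 1 ≤ ℓ →
      P (ℓ + 1) = Polynomial.X * (1 - Polynomial.X) * (P ℓ).derivative)
    {lam : ℝ} (hlam : lam ∈ Set.Ioo (0 : ℝ) 1) {ℓ : ℕ} (hℓ : 1 ≤ ℓ) :
    iteratedDeriv ℓ (fun t : ℝ => Real.log (1 + (Real.exp t - 1) * lam))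
      = fun t => (P ℓ).eval (Real.exp t * lam / (1 + (Real.exp t - 1) * lam)) := by
  induction ℓ, hℓ using Nat.le_induction with
  | base =>
    funext t
    rw [iteratedDeriv_one, hP1, Polynomial.eval_X]
    exact ((hasDerivAt_one_add_exp_sub_one_mul lam t).log
      (one_add_exp_sub_one_mul_pos hlam t).ne').deriv
  | succ n hn ih =>
    funext t
    rw [iteratedDeriv_succ, ih, hPrec n hn]
    have h := ((P n).hasDerivAt _).comp t (hasDerivAt_tilted_bernoulli_mean hlam t)
    refine h.deriv.trans ?_
    simp only [Polynomial.eval_mul, Polynomial.eval_sub, Polynomial.eval_X, Polynomial.eval_one]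
    ring

/-- The polynomials defined by `P_1 = X`, `P_{ℓ+1} = X(1-X) P_ℓ'` give
the cumulants of the Bernoulli distribution: the `ℓ`-th derivative at `t = 0` of
`t ↦ ln(1 + (e^t - 1)λ)` equals `P_ℓ(λ)` for all `λ ∈ (0,1)` and `ℓ ≥ 1`. -/
theorem bernoulli_cumulants_polynomials
    (P : ℕ → Polynomial ℝ)
    (hP1 : P 1 = Polynomial.X)
    (hPrec : ∀ ℓ : ℕ, 1 ≤ ℓ →
      P (ℓ + 1) = Polynomial.X * (1 - Polynomial.X) * (P ℓ).derivative)
    (lam : ℝ) (hlam : lam ∈ Set.Ioo (0 : ℝ) 1)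
    (ℓ : ℕ) (hℓ : 1 ≤ ℓ) :
    iteratedDeriv ℓ (fun t : ℝ => Real.log (1 + (Real.exp t - 1) * lam)) 0
      = (P ℓ).eval lam := by
  simp [iteratedDeriv_bernoulli_cgf P hP1 hPrec hlam hℓ]
end

section
/- Let P be a real polynomial with P(0) = P(1) = 0. Then for every α > 0 the series Σ_{m ∈ ℤ} P(er(α m)) converges absolutely, the integral I(P) = ∫_ℝ P(er(x)) dx converges, and for every N ∈ ℕ there exist C_N > 0 and α₀ > 0 such that for all 0 < α ≤ α₀, | Σ_{m ∈ ℤ} P(er(α m)) − α^{-1} I(P) | ≤ C_N α^N. -/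
open MeasureTheory Real

open scoped SchwartzMap FourierTransform

namespace SchwartzMap

/-- A function with rapid decay whose derivative is a Schwartz function is itself a Schwartz
function. -/
theorem exists_eq_of_hasDerivAt {f : ℝ → ℝ} (g : 𝓢(ℝ, ℝ)) (hf : ∀ x, HasDerivAt f (g x) x)
    (hdecay : ∀ k : ℕ, ∃ C : ℝ, ∀ x, |x| ^ k * |f x| ≤ C) :
    ∃ F : 𝓢(ℝ, ℝ), ∀ x, F x = f x := by
  have hderiv : deriv f = g := funext fun x => (hf x).deriv
  refine ⟨⟨f, ?_, fun k n => ?_⟩, fun _ => rfl⟩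
  · refine contDiff_infty_iff_deriv.2 ⟨fun x => (hf x).differentiableAt, ?_⟩
    rw [hderiv]
    exact g.smooth _
  · rcases n with _ | n
    · obtain ⟨C, hC⟩ := hdecay k
      exact ⟨C, fun x => by simpa using hC x⟩
    · obtain ⟨C, hC⟩ := g.decay k n
      refine ⟨C, fun x => ?_⟩
      rw [norm_iteratedFDeriv_eq_norm_iteratedDeriv, iteratedDeriv_succ', hderiv,
        ← norm_iteratedFDeriv_eq_norm_iteratedDeriv]
      exact hC.2 x

theorem abs_pow_le_factorial_mul_exp_abs (x : ℝ) (n : ℕ) : |x| ^ n ≤ n.factorial * exp |x| := by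
  have := pow_div_factorial_le_exp |x| (abs_nonneg x) n
  rwa [div_le_iff₀' (by positivity)] at this

theorem exists_abs_eval_mul_exp_neg_sq_le (q : Polynomial ℝ) :
    ∃ C : ℝ, ∀ x : ℝ, |q.eval x * exp (-x ^ 2)| ≤ C := by
  induction q using Polynomial.induction_on' with
  | add p q hp hq =>
    obtain ⟨A, hA⟩ := hp
    obtain ⟨B, hB⟩ := hq
    refine ⟨A + B, fun x => ?_⟩
    rw [Polynomial.eval_add, add_mul]
    exact (abs_add_le _ _).trans (add_le_add (hA x) (hB x))
  | monomial n a =>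
    refine ⟨|a| * (n.factorial * exp 1), fun x => ?_⟩
    rw [Polynomial.eval_monomial, mul_assoc, abs_mul, abs_mul, abs_pow, abs_exp]
    refine mul_le_mul_of_nonneg_left ?_ (abs_nonneg a)
    have h1 := abs_pow_le_factorial_mul_exp_abs x n
    calc |x| ^ n * exp (-x ^ 2) ≤ n.factorial * exp |x| * exp (-x ^ 2) := by gcongr
      _ = n.factorial * exp (|x| - x ^ 2) := by rw [mul_assoc, ← exp_add, sub_eq_add_neg]
      _ ≤ _ := by
        gcongr
        nlinarith [sq_nonneg (|x| - 1), sq_abs x, abs_nonneg x]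

theorem exists_iteratedDeriv_exp_neg_sq (n : ℕ) :
    ∃ q : Polynomial ℝ,
      iteratedDeriv n (fun x : ℝ => exp (-x ^ 2)) = fun x => q.eval x * exp (-x ^ 2) := by
  induction n with
  | zero => exact ⟨1, by simp⟩
  | succ n ih =>
    obtain ⟨q, hq⟩ := ih
    refine ⟨q.derivative - 2 * Polynomial.X * q, funext fun x => ?_⟩
    rw [iteratedDeriv_succ, hq]
    have h := (q.hasDerivAt x).mul ((hasDerivAt_pow 2 x).neg.exp)
    refine h.deriv.trans ?_
    simp
    ring

/-- The Gaussian `exp (-x ^ 2)` as a Schwartz function. -/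
noncomputable def expNegSq : 𝓢(ℝ, ℝ) where
  toFun x := exp (-x ^ 2)
  smooth' := by fun_prop
  decay' k n := by
    obtain ⟨q, hq⟩ := exists_iteratedDeriv_exp_neg_sq n
    obtain ⟨C, hC⟩ := exists_abs_eval_mul_exp_neg_sq_le (Polynomial.X ^ k * q)
    refine ⟨C, fun x => ?_⟩
    rw [norm_iteratedFDeriv_eq_norm_iteratedDeriv, hq]
    refine le_trans (le_of_eq ?_) (hC x)
    simp [abs_mul, mul_assoc]

theorem expNegSq_apply (x : ℝ) : expNegSq x = exp (-x ^ 2) := rfl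

theorem summable_comp_mul_int (f : 𝓢(ℝ, ℝ)) {α : ℝ} (hα : 0 < α) :
    Summable fun m : ℤ => |f (α * m)| := by
  obtain ⟨C, hC⟩ := f.decay 2 0
  refine Summable.of_norm_bounded_eventually
    (g := fun m : ℤ => C / α ^ 2 * (1 / (m : ℝ) ^ 2))
    ((Real.summable_one_div_int_pow.2 one_lt_two).mul_left _) ?_
  filter_upwards [(Set.finite_singleton (0 : ℤ)).compl_mem_cofinite] with m hm
  have hm : (m : ℝ) ≠ 0 := by exact_mod_cast hm
  have h := hC.2 (α * m)
  rw [norm_iteratedFDeriv_zero, norm_eq_abs, norm_eq_abs, sq_abs] at h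
  rw [norm_eq_abs, abs_abs, div_mul_div_comm, mul_one, ← mul_pow, le_div_iff₀ (by positivity)]
  linarith

theorem fourier_comp_mul_left (f : ℝ → ℂ) {α : ℝ} (hα : 0 < α) (ξ : ℝ) :
    𝓕 (fun x => f (α * x)) ξ = α⁻¹ * 𝓕 f (ξ / α) := by
  rw [Real.fourier_real_eq_integral_exp_smul, Real.fourier_real_eq_integral_exp_smul]
  have h := Measure.integral_comp_mul_left
    (fun v : ℝ => Complex.exp (↑(-2 * π * v * (ξ / α)) * Complex.I) • f v) α
  rw [abs_of_pos (inv_pos.2 hα), Complex.real_smul] at h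
  rw [← h]
  congr 1 with x
  congr 4
  field_simp

/-- Riemann sums of a Schwartz function over `α ℤ` approximate its integral to infinite order
as `α → 0⁺`. -/
theorem exists_norm_tsum_sub_integral_le (f : 𝓢(ℝ, ℂ)) (N : ℕ) :
    ∃ C : ℝ, 0 < C ∧ ∀ α : ℝ, 0 < α → α ≤ 1 →
      ‖(∑' m : ℤ, f (α * m)) - (α : ℂ)⁻¹ * ∫ x, f x‖ ≤ C * α ^ N := by
  obtain ⟨K, hK, hdecay⟩ := (𝓕 f).decay (N + 2) 0
  set S : ℝ := ∑' m : ℤ, 1 / (m : ℝ) ^ 2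
  have hsum : Summable fun m : ℤ => 1 / (m : ℝ) ^ 2 := Real.summable_one_div_int_pow.2 one_lt_two
  have hS : 0 ≤ S := tsum_nonneg fun m => by positivity
  refine ⟨K * S + 1, by positivity, fun α hα hα1 => ?_⟩
  let e : ℝ ≃L[ℝ] ℝ := ContinuousLinearEquiv.unitsEquivAut ℝ (Units.mk0 α hα.ne')
  let fα : 𝓢(ℝ, ℂ) := compCLMOfContinuousLinearEquiv ℂ e f
  have hfα : (fα : ℝ → ℂ) = fun x => f (α * x) := by
    ext x
    simp [fα, e, mul_comm]
  have hF (ξ : ℝ) : 𝓕 fα ξ = (α : ℂ)⁻¹ * 𝓕 f (ξ / α) := by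
    rw [fourier_coe, fourier_coe, hfα, fourier_comp_mul_left _ hα, Complex.ofReal_inv]
  have hpoisson := fα.tsum_eq_tsum_fourier 0
  have hsF : Summable fun m : ℤ => 𝓕 fα m := by
    have := (𝓕 fα).isBigO_cocompact_rpow (-2)
    exact summable_of_isBigO (Real.summable_abs_int_rpow one_lt_two)
      (this.comp_tendsto Int.tendsto_coe_cofinite)
  have h0 : 𝓕 f 0 = ∫ x, f x := by
    rw [fourier_coe, Real.fourier_real_eq_integral_exp_smul]
    simp
  have hl : ∑' m : ℤ, f (α * m) = ∑' m : ℤ, 𝓕 fα m := by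
    simpa [hfα] using hpoisson
  rw [hl, hsF.tsum_eq_add_tsum_ite 0, Int.cast_zero, hF, zero_div, h0, add_sub_cancel_left]
  have hb : ∀ m : ℤ, ‖(if m = 0 then 0 else 𝓕 fα m)‖ ≤ K * α ^ N * (1 / (m : ℝ) ^ 2) := by
    intro m
    split_ifs with hm
    · simp [hm]
    · have hm1 : 1 ≤ |(m : ℝ)| := by exact_mod_cast Int.one_le_abs hm
      have h := hdecay (m / α)
      rw [norm_iteratedFDeriv_zero, norm_eq_abs, abs_div, abs_of_pos hα, div_pow,
        div_mul_eq_mul_div, div_le_iff₀ (by positivity)] at h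
      have hm2 : |(m : ℝ)| ^ 2 ≤ |(m : ℝ)| ^ (N + 2) := pow_le_pow_right₀ hm1 (by lia)
      rw [hF, norm_mul, norm_inv, Complex.norm_real, norm_of_nonneg hα.le, ← sq_abs (m : ℝ),
        mul_one_div, le_div_iff₀ (by positivity), inv_mul_eq_div, div_mul_eq_mul_div,
        div_le_iff₀ hα]
      calc ‖𝓕 f (m / α)‖ * |(m : ℝ)| ^ 2 ≤ |(m : ℝ)| ^ (N + 2) * ‖𝓕 f (m / α)‖ := by
            rw [mul_comm]; gcongr
        _ ≤ K * α ^ (N + 2) := h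
        _ ≤ K * α ^ (N + 1) := by
            gcongr ?_ * ?_
            exact pow_le_pow_of_le_one hα.le hα1 (by lia)
        _ = K * α ^ N * α := by ring
  calc _ ≤ K * α ^ N * S := tsum_of_norm_bounded (hsum.hasSum.mul_left _) hb
    _ = K * S * α ^ N := by ring
    _ ≤ (K * S + 1) * α ^ N := by gcongr; linarith

section GaussianDistribution

variable {er : ℝ → ℝ}

theorem integrable_exp_neg_sq : Integrable fun t : ℝ => exp (-t ^ 2) :=
  expNegSq.integrable

theorem setIntegral_Iic_exp_neg_sq_le (x : ℝ) :
    ∫ t in Set.Iic x, exp (-t ^ 2) ≤ exp 1 * exp x := by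
  rw [← integral_exp_Iic x, ← integral_const_mul]
  refine setIntegral_mono integrable_exp_neg_sq.integrableOn
    ((integrableOn_exp_Iic x).const_mul _) fun t => ?_
  rw [← exp_add]
  gcongr
  nlinarith [sq_nonneg (t + 1 / 2)]

theorem hasDerivAt_setIntegral_Iic_exp_neg_sq (x : ℝ) :
    HasDerivAt (fun x => ∫ t in Set.Iic x, exp (-t ^ 2)) (exp (-x ^ 2)) x := by
  have hc : Continuous fun t : ℝ => exp (-t ^ 2) := by fun_prop
  have h := (hc.integral_hasStrictDerivAt 0 x).hasDerivAt.add_const (∫ t in Set.Iic 0, exp (-t ^ 2))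
  refine h.congr_of_eventuallyEq (.of_forall fun y => ?_)
  simp only
  rw [← intervalIntegral.integral_Iic_sub_Iic integrable_exp_neg_sq.integrableOn
    integrable_exp_neg_sq.integrableOn, sub_add_cancel]

theorem setIntegral_Iic_add_Iic_neg_exp_neg_sq (x : ℝ) :
    (∫ t in Set.Iic x, exp (-t ^ 2)) + ∫ t in Set.Iic (-x), exp (-t ^ 2) = √π := by
  have h := integral_comp_neg_Iic (-x) fun t : ℝ => exp (-t ^ 2)
  simp only [neg_sq, neg_neg] at h
  have hg := integral_gaussian 1
  simp only [neg_mul, one_mul, div_one] at hg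
  rw [h, intervalIntegral.integral_Iic_add_Ioi integrable_exp_neg_sq.integrableOn
    integrable_exp_neg_sq.integrableOn, hg]

theorem hasDerivAt_gaussian_distribution
    (her : ∀ x, er x = (√π)⁻¹ * ∫ t in Set.Iic x, exp (-t ^ 2)) (x : ℝ) :
    HasDerivAt er ((√π)⁻¹ * exp (-x ^ 2)) x := by
  rw [funext her]
  exact (hasDerivAt_setIntegral_Iic_exp_neg_sq x).const_mul _

theorem gaussian_distribution_add_neg
    (her : ∀ x, er x = (√π)⁻¹ * ∫ t in Set.Iic x, exp (-t ^ 2)) (x : ℝ) :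
    er x + er (-x) = 1 := by
  rw [her, her, ← mul_add, setIntegral_Iic_add_Iic_neg_exp_neg_sq]
  exact inv_mul_cancel₀ (by positivity)

theorem gaussian_distribution_nonneg
    (her : ∀ x, er x = (√π)⁻¹ * ∫ t in Set.Iic x, exp (-t ^ 2)) (x : ℝ) : 0 ≤ er x := by
  rw [her]
  exact mul_nonneg (by positivity) (integral_nonneg fun t => (exp_pos _).le)

theorem hasTemperateGrowth_gaussian_distribution
    (her : ∀ x, er x = (√π)⁻¹ * ∫ t in Set.Iic x, exp (-t ^ 2)) :
    Function.HasTemperateGrowth er := by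
  have hd := hasDerivAt_gaussian_distribution her
  refine .of_fderiv (k := 0) (C := 1) ?_ (fun x => (hd x).differentiableAt) fun x => ?_
  · have : fderiv ℝ er = fun x =>
        (ContinuousLinearMap.toSpanSingletonCLE (𝕜 := ℝ) : ℝ ≃L[ℝ] ℝ →L[ℝ] ℝ)
          ((√π)⁻¹ * expNegSq x) := by
      ext x
      simp [(hd x).hasFDerivAt.fderiv, expNegSq_apply]
    rw [this]
    have := expNegSq.hasTemperateGrowth
    have h2 := (ContinuousLinearMap.toSpanSingletonCLE (𝕜 := ℝ) :
      ℝ ≃L[ℝ] ℝ →L[ℝ] ℝ).hasTemperateGrowth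
    exact h2.comp (by fun_prop)
  · have h1 := gaussian_distribution_add_neg her x
    have h2 := gaussian_distribution_nonneg her x
    have h3 := gaussian_distribution_nonneg her (-x)
    rw [norm_of_nonneg h2, pow_zero]
    linarith

theorem exists_eq_gaussian_distribution_mul_one_sub
    (her : ∀ x, er x = (√π)⁻¹ * ∫ t in Set.Iic x, exp (-t ^ 2)) :
    ∃ F : 𝓢(ℝ, ℝ), ∀ x, F x = er x * (1 - er x) := by
  have hd := hasDerivAt_gaussian_distribution her
  have ht := hasTemperateGrowth_gaussian_distribution her
  have hg : Function.HasTemperateGrowth fun x => (√π)⁻¹ * (1 - 2 * er x) := by fun_prop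
  refine exists_eq_of_hasDerivAt (smulLeftCLM ℝ (fun x => (√π)⁻¹ * (1 - 2 * er x)) expNegSq)
    (fun x => ?_) fun k => ?_
  · rw [smulLeftCLM_apply_apply hg, expNegSq_apply]
    convert! (hd x).mul ((hd x).const_sub 1) using 1
    rw [smul_eq_mul]
    ring
  · refine ⟨k.factorial * ((√π)⁻¹ * exp 1), fun x => ?_⟩
    have hs (x : ℝ) : 1 - er x = er (-x) := by linarith [gaussian_distribution_add_neg her x]
    have h0 := gaussian_distribution_nonneg her
    have hle (x : ℝ) : er x ≤ (√π)⁻¹ * exp 1 * exp x := by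
      rw [her, mul_assoc]
      gcongr
      exact setIntegral_Iic_exp_neg_sq_le x
    have hle1 (x : ℝ) : er x ≤ 1 := by linarith [hs x, h0 (-x)]
    have hb : er x * er (-x) ≤ (√π)⁻¹ * exp 1 * exp (-|x|) := by
      rcases le_total 0 x with hx | hx
      · rw [abs_of_nonneg hx]
        exact (mul_le_of_le_one_left (h0 _) (hle1 _)).trans (hle _)
      · rw [abs_of_nonpos hx, neg_neg]
        exact (mul_le_of_le_one_right (h0 _) (hle1 _)).trans (hle _)
    have hp := abs_pow_le_factorial_mul_exp_abs x k
    rw [hs, abs_of_nonneg (mul_nonneg (h0 _) (h0 _))]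
    calc |x| ^ k * (er x * er (-x))
        ≤ (k.factorial * exp |x|) * ((√π)⁻¹ * exp 1 * exp (-|x|)) :=
          mul_le_mul hp hb (mul_nonneg (h0 _) (h0 _)) (by positivity)
      _ = k.factorial * ((√π)⁻¹ * exp 1) * (exp |x| * exp (-|x|)) := by ring
      _ = _ := by rw [← exp_add, add_neg_cancel, exp_zero, mul_one]

theorem exists_eq_eval_gaussian_distribution
    (her : ∀ x, er x = (√π)⁻¹ * ∫ t in Set.Iic x, exp (-t ^ 2))
    (P : Polynomial ℝ) (hP0 : P.eval 0 = 0) (hP1 : P.eval 1 = 0) :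
    ∃ F : 𝓢(ℝ, ℝ), ∀ x, F x = P.eval (er x) := by
  obtain ⟨Q, rfl⟩ : Polynomial.X ∣ P :=
    Polynomial.X_dvd_iff.2 (by rwa [Polynomial.coeff_zero_eq_eval_zero])
  have hQ : Q.IsRoot 1 := by simpa using hP1
  obtain ⟨R, rfl⟩ := Polynomial.dvd_iff_isRoot.2 hQ
  have ht := hasTemperateGrowth_gaussian_distribution her
  have hR : Function.HasTemperateGrowth fun x => -R.eval (er x) := by
    simp_rw [Polynomial.eval_eq_sum_range]
    refine Function.HasTemperateGrowth.neg (Function.HasTemperateGrowth.sum fun i _ => ?_)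
    exact (Function.HasTemperateGrowth.const _).mul (ht.pow i)
  obtain ⟨F, hF⟩ := exists_eq_gaussian_distribution_mul_one_sub her
  refine ⟨smulLeftCLM ℝ (fun x => -R.eval (er x)) F, fun x => ?_⟩
  rw [smulLeftCLM_apply_apply hR, hF]
  simp
  ring

end GaussianDistribution

end SchwartzMap

/-- For a real polynomial `P` with `P(0) = P(1) = 0`, the series
`Σ_{m∈ℤ} P(er(αm))` converges absolutely for every `α > 0`, `x ↦ P(er(x))` is
integrable on `ℝ`, and `Σ_{m∈ℤ} P(er(αm)) = α⁻¹ I(P) + O(α^∞)` as `α → 0⁺`. -/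
theorem polynomial_er_sum_asymptotics
    (er : ℝ → ℝ)
    (her : ∀ x : ℝ, er x = (Real.sqrt π)⁻¹ * ∫ t in Set.Iic x, Real.exp (-t ^ 2))
    (P : Polynomial ℝ) (hP0 : P.eval 0 = 0) (hP1 : P.eval 1 = 0) :
    (∀ α : ℝ, 0 < α → Summable fun m : ℤ => |P.eval (er (α * m))|) ∧
    Integrable (fun x : ℝ => P.eval (er x)) ∧
    ∀ N : ℕ, ∃ C : ℝ, 0 < C ∧ ∃ α₀ : ℝ, 0 < α₀ ∧
      ∀ α : ℝ, 0 < α → α ≤ α₀ →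
        |(∑' m : ℤ, P.eval (er (α * m))) - α⁻¹ * ∫ x : ℝ, P.eval (er x)|
          ≤ C * α ^ N := by
  obtain ⟨F, hF⟩ := SchwartzMap.exists_eq_eval_gaussian_distribution her P hP0 hP1
  simp_rw [← hF]
  refine ⟨fun α hα => F.summable_comp_mul_int hα, F.integrable, fun N => ?_⟩
  obtain ⟨C, hC, h⟩ := (F.postcompCLM Complex.ofRealCLM).exists_norm_tsum_sub_integral_le N
  refine ⟨C, hC, 1, one_pos, fun α hα hα1 => ?_⟩
  have := h α hα hα1
  simp only [SchwartzMap.postcompCLM_apply, Complex.ofRealCLM_apply] at this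
  rwa [← Complex.ofReal_tsum, integral_complex_ofReal, ← Complex.ofReal_inv, ← Complex.ofReal_mul,
    ← Complex.ofReal_sub, Complex.norm_real, norm_eq_abs] at this
end
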